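/- arXiv:2506.23632 — 3 statements merged into one kernel-verified Lean document; each statement's English description precedes it below -/
import Mathlib

section
/- Let B be a bicategory, and let l : y ⟶ x and r : x ⟶ y be 1-morphisms forming an adjunction l ⊣ r, with unit η : 𝟙 y ⟶ l ≫ r and counit ε : r ≫ l ⟶ 𝟙 x. Then for every 1-morphism f : x ⟶ y and every 1-morphism g : y ⟶ y there is a bijection between 2-morphisms r ≫ g ⟶ f and 2-morphisms g ⟶ l ≫ f, natural in g and in f, sending α : r ≫ g ⟶ f to the composite g ≅ 𝟙 y ≫ g ⟶ (l ≫ r) ≫ g ≅ l ≫ (r ≫ g) ⟶ l ≫ f built from η and whiskering with α (the inverse is built analogously from ε). In particular, taking f = r, this exhibits the 1-morphism l ≫ r as an endomorphism object of r with respect to the action of End(y) on Hom(x,y) by postcomposition. -/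
open CategoryTheory CategoryTheory.Bicategory

namespace Stmt0

variable {B : Type*} [Bicategory B]

/-- The map sending a 2-morphism `α : r ≫ g ⟶ f` to the composite
`g ≅ 𝟙 y ≫ g ⟶ (l ≫ r) ≫ g ≅ l ≫ (r ≫ g) ⟶ l ≫ f` built from the unit of the
adjunction and whiskering with `α`. -/
def transfer {x y : B} {l : y ⟶ x} {r : x ⟶ y} (adj : Bicategory.Adjunction l r)
    (f : x ⟶ y) (g : y ⟶ y) (α : r ≫ g ⟶ f) : g ⟶ l ≫ f :=
  (λ_ g).inv ≫ adj.unit ▷ g ≫ (α_ l r g).hom ≫ l ◁ α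

/-- For an adjunction `l ⊣ r` in a bicategory, the map `transfer` is a bijection
`(r ≫ g ⟶ f) ≃ (g ⟶ l ≫ f)`, natural in `g` and in `f`.  In particular, taking `f = r`,
this exhibits `l ≫ r` as an endomorphism object of `r` for the action of `End (y)` on
`Hom (x, y)` by postcomposition. -/
theorem adjoint_endomorphism_monad {x y : B} (l : y ⟶ x) (r : x ⟶ y)
    (adj : Bicategory.Adjunction l r) :
    (∀ (f : x ⟶ y) (g : y ⟶ y), Function.Bijective (transfer adj f g)) ∧
    (∀ (f : x ⟶ y) (g g' : y ⟶ y) (h : g' ⟶ g) (α : r ≫ g ⟶ f),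
      transfer adj f g' (r ◁ h ≫ α) = h ≫ transfer adj f g α) ∧
    (∀ (f f' : x ⟶ y) (g : y ⟶ y) (k : f ⟶ f') (α : r ≫ g ⟶ f),
      transfer adj f' g (α ≫ k) = transfer adj f g α ≫ l ◁ k) := by
  refine ⟨fun f g => (adj.homEquiv₁ (g := g) (h := f)).symm.bijective, ?_, ?_⟩
  · intro f g g' h α
    simp only [transfer, whiskerLeft_comp, ← associator_naturality_right_assoc,
      ← whisker_exchange_assoc, leftUnitor_inv_naturality_assoc]
  · intro f f' g k α
    simp [transfer]

end Stmt0
end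

section
/- Let C be a category and let T and S be monads on C. Every morphism of monads f : T ⟶ S induces a restriction functor f* from the Eilenberg–Moore category of S-algebras to the Eilenberg–Moore category of T-algebras, sending an S-algebra (X, a : S X ⟶ X) to the T-algebra (X, f_X ≫ a), and this functor strictly commutes with the forgetful functors to C. Moreover, the assignment f ↦ f* is a bijection from the set of monad morphisms T ⟶ S to the set of functors G from S-algebras to T-algebras satisfying G ⋙ (forgetful to C) = (forgetful to C). -/
open CategoryTheory

namespace CategoryTheory.Monad

section Lift

variable {C : Type*} [Category C] {D : Type*} [Category D]

/-- A functor to `T`-algebras built from a functor `F : D ⥤ C` and an action of `T` on `F`. -/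
def algebraLift (T : Monad C) (F : D ⥤ C) (α : ∀ X, T.obj (F.obj X) ⟶ F.obj X)
    (nat : ∀ {X Y : D} (g : X ⟶ Y), T.map (F.map g) ≫ α Y = α X ≫ F.map g)
    (unit : ∀ X, T.η.app (F.obj X) ≫ α X = 𝟙 (F.obj X))
    (assoc : ∀ X, T.μ.app (F.obj X) ≫ α X = T.map (α X) ≫ α X) :
    D ⥤ T.Algebra where
  obj X := { A := F.obj X, a := α X, unit := unit X, assoc := assoc X }
  map g := { f := F.map g, h := nat g }

theorem algebraLift_congr (T : Monad C) (F : D ⥤ C) {α β : ∀ X, T.obj (F.obj X) ⟶ F.obj X}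
    (nat : ∀ {X Y : D} (g : X ⟶ Y), T.map (F.map g) ≫ α Y = α X ≫ F.map g)
    (unit : ∀ X, T.η.app (F.obj X) ≫ α X = 𝟙 (F.obj X))
    (assoc : ∀ X, T.μ.app (F.obj X) ≫ α X = T.map (α X) ≫ α X)
    (nat' : ∀ {X Y : D} (g : X ⟶ Y), T.map (F.map g) ≫ β Y = β X ≫ F.map g)
    (unit' : ∀ X, T.η.app (F.obj X) ≫ β X = 𝟙 (F.obj X))
    (assoc' : ∀ X, T.μ.app (F.obj X) ≫ β X = T.map (β X) ≫ β X) (h : α = β) :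
    algebraLift T F α nat unit assoc = algebraLift T F β nat' unit' assoc' := by
  subst h
  rfl

/-- Every functor to `T`-algebras lying over `F` comes from an action of `T` on `F`. -/
theorem exists_eq_algebraLift (T : Monad C) (F : D ⥤ C) (G : D ⥤ T.Algebra)
    (h : G ⋙ T.forget = F) :
    ∃ (α : ∀ X, T.obj (F.obj X) ⟶ F.obj X)
      (nat : ∀ {X Y : D} (g : X ⟶ Y), T.map (F.map g) ≫ α Y = α X ≫ F.map g)
      (unit : ∀ X, T.η.app (F.obj X) ≫ α X = 𝟙 (F.obj X))
      (assoc : ∀ X, T.μ.app (F.obj X) ≫ α X = T.map (α X) ≫ α X),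
      G = algebraLift T F α nat unit assoc := by
  subst h
  exact ⟨fun X => (G.obj X).a, fun g => (G.map g).h,
    fun X => (G.obj X).unit, fun X => (G.obj X).assoc, rfl⟩

end Lift

variable {C : Type*} [Category C] {T S : Monad C}

/-- The monad morphism induced by an action of `T` on the underlying functor of `S` which is
compatible with the multiplication of `S`. -/
def homOfAction (β : ∀ X, T.obj (S.obj X) ⟶ S.obj X)
    (nat : ∀ {X Y : C} (g : X ⟶ Y), T.map (S.map g) ≫ β Y = β X ≫ S.map g)
    (unit : ∀ X, T.η.app (S.obj X) ≫ β X = 𝟙 (S.obj X))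
    (assoc : ∀ X, T.μ.app (S.obj X) ≫ β X = T.map (β X) ≫ β X)
    (mul : ∀ X, T.map (S.μ.app X) ≫ β X = β (S.obj X) ≫ S.μ.app X) :
    T ⟶ S where
  app X := T.map (S.η.app X) ≫ β X
  naturality X Y g := by
    have h : g ≫ S.η.app Y = S.η.app X ≫ S.map g := S.η.naturality g
    rw [← Category.assoc, ← T.map_comp, h, T.map_comp, Category.assoc, nat, Category.assoc]
  app_η X := by
    have h : S.η.app X ≫ T.η.app (S.obj X) = T.η.app X ≫ T.map (S.η.app X) :=
      T.η.naturality (S.η.app X)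
    rw [← Category.assoc, ← h, Category.assoc, unit]
    exact Category.comp_id _
  app_μ X := by
    have h₁ : T.map (T.map (S.η.app X)) ≫ T.μ.app (S.obj X) = T.μ.app X ≫ T.map (S.η.app X) :=
      T.μ.naturality (S.η.app X)
    have h₂ : T.map (S.η.app (S.obj X)) ≫ T.map (S.μ.app X) = 𝟙 (T.obj (S.obj X)) := by
      rw [← T.map_comp, S.left_unit]
      exact T.map_id _
    rw [← Category.assoc, ← h₁, Category.assoc, assoc, T.map_comp, Category.assoc,
      Category.assoc, Category.assoc, ← mul, reassoc_of% h₂]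

theorem map_unit_comp_of_compat (A : S.Algebra) {a : T.obj A.A ⟶ A.A}
    {b : T.obj (S.obj A.A) ⟶ S.obj A.A} (h : T.map A.a ≫ a = b ≫ A.a) :
    (T.map (S.η.app A.A) ≫ b) ≫ A.a = a := by
  have h' : T.map (S.η.app A.A) ≫ T.map A.a = 𝟙 (T.obj A.A) := by
    rw [← T.map_comp, A.unit]
    exact T.map_id _
  rw [Category.assoc, ← h, reassoc_of% h']

theorem algebraFunctorOfMonadHom_injective :
    Function.Injective (algebraFunctorOfMonadHom : (T ⟶ S) → S.Algebra ⥤ T.Algebra) := by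
  intro f g h
  have key (A : S.Algebra) : f.app A.A ≫ A.a = g.app A.A ≫ A.a := by
    have hA := Functor.congr_obj h A
    simp only [algebraFunctorOfMonadHom, Algebra.mk.injEq, heq_eq_eq, true_and] at hA
    exact hA
  have recover (k : T ⟶ S) (X : C) :
      T.map (S.η.app X) ≫ k.app (S.obj X) ≫ S.μ.app X = k.app X := by
    have hk : T.map (S.η.app X) ≫ k.app (S.obj X) = k.app X ≫ S.map (S.η.app X) :=
      k.naturality (S.η.app X)
    rw [← Category.assoc, hk, Category.assoc, S.right_unit]
    exact Category.comp_id _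
  ext X
  rw [← recover f, ← recover g]
  exact congrArg _ (key (S.free.obj X))

theorem exists_algebraFunctorOfMonadHom_eq (G : S.Algebra ⥤ T.Algebra)
    (h : G ⋙ T.forget = S.forget) : ∃ f : T ⟶ S, algebraFunctorOfMonadHom f = G := by
  obtain ⟨α, nat, unit, assoc, rfl⟩ := exists_eq_algebraLift T S.forget G h
  have compat (A : S.Algebra) : T.map A.a ≫ α A = α (S.free.obj A.A) ≫ A.a :=
    nat (X := S.free.obj A.A) { f := A.a, h := A.assoc.symm }
  let f : T ⟶ S := homOfAction (fun X => α (S.free.obj X)) (fun g => nat (S.free.map g))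
    (fun X => unit (S.free.obj X)) (fun X => assoc (S.free.obj X))
    (fun X => compat (S.free.obj X))
  have hf (A : S.Algebra) : f.app A.A ≫ A.a = α A := map_unit_comp_of_compat A (compat A)
  exact ⟨f, algebraLift_congr T S.forget
    (fun g => ((algebraFunctorOfMonadHom f).map g).h)
    (fun A => ((algebraFunctorOfMonadHom f).obj A).unit)
    (fun A => ((algebraFunctorOfMonadHom f).obj A).assoc) nat unit assoc (funext hf)⟩

end CategoryTheory.Monad

/-- For monads `T` and `S` on a category `C`, every morphism of monads `f : T ⟶ S` induces a
restriction functor from `S`-algebras to `T`-algebras, sending `(X, a : S X ⟶ X)` to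
`(X, f_X ≫ a)`; it strictly commutes with the forgetful functors, and `f ↦ f*` is a
bijection from monad morphisms `T ⟶ S` to functors `G : S.Algebra ⥤ T.Algebra` with
`G ⋙ T.forget = S.forget`. -/
theorem monadHom_restriction_bijective {C : Type*} [Category C] (T S : Monad C) :
    (∀ (f : T ⟶ S) (A : S.Algebra),
        ((Monad.algebraFunctorOfMonadHom f).obj A).A = A.A) ∧
    (∀ (f : T ⟶ S) (A : S.Algebra),
        ((Monad.algebraFunctorOfMonadHom f).obj A).a = f.app A.A ≫ A.a) ∧
    (∀ f : T ⟶ S, Monad.algebraFunctorOfMonadHom f ⋙ T.forget = S.forget) ∧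
    Function.Bijective
      (fun f : T ⟶ S =>
        (⟨Monad.algebraFunctorOfMonadHom f, rfl⟩ :
          {G : S.Algebra ⥤ T.Algebra // G ⋙ T.forget = S.forget})) := by
  refine ⟨fun _ _ => rfl, fun _ _ => rfl, fun _ => rfl, fun f g h => ?_, fun ⟨G, hG⟩ => ?_⟩
  · exact Monad.algebraFunctorOfMonadHom_injective (congrArg Subtype.val h)
  · obtain ⟨f, hf⟩ := Monad.exists_algebraFunctorOfMonadHom_eq G hG
    exact ⟨f, Subtype.ext hf⟩
end

section
/- Let C be a category, let T and S be monads on C, and let f : T ⟶ S be a morphism of monads. Suppose the Eilenberg–Moore category of S-algebras has coequalizers of reflexive pairs (for instance, this holds when C has reflexive coequalizers and S preserves them). Then the restriction-of-scalars functor f* from S-algebras to T-algebras admits a left adjoint (extension of scalars along f). -/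
open CategoryTheory CategoryTheory.Limits

/-- Let `T` and `S` be monads on `C` and `f : T ⟶ S` a morphism of monads.  If the
Eilenberg–Moore category of `S`-algebras has coequalizers of reflexive pairs, then the
restriction-of-scalars functor `f* : S.Algebra ⥤ T.Algebra` admits a left adjoint
(extension of scalars along `f`). -/
theorem restriction_of_scalars_isRightAdjoint {C : Type*} [Category C]
    (T S : Monad C) (f : T ⟶ S) [HasReflexiveCoequalizers S.Algebra] :
    (Monad.algebraFunctorOfMonadHom f).IsRightAdjoint := by
  have : (Monad.algebraFunctorOfMonadHom f ⋙ T.forget).IsRightAdjoint :=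
    S.adj.isRightAdjoint
  exact isRightAdjoint_triangle_lift _ T.adj fun X => by
    simp only [Monad.adj_counit]
    exact ⟨_, _, _, _, Monad.beckAlgebraCoequalizer X⟩
end
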